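/- arXiv:2212.12692 — 4 statements merged into one kernel-verified Lean document; each statement's English description precedes it below -/
import Mathlib

section
/- Let α ∈ (0,1), let A be a real symmetric positive semidefinite d×d matrix, let f : ℝ^d → ℝ be continuous with f(y) ≥ 0 for all y, let T > 0 and z₀ ∈ ℝ^d. Then there exists a continuous function z : [0,T] → ℝ^d satisfying z(t) = z₀ − (1/Γ(α)) ∫₀^t (t−s)^{α−1} f(z(s))·(A z(s)) ds for every t ∈ [0,T]; moreover this solution satisfies ‖z(t)‖ ≤ ‖z₀‖ for all t ∈ [0,T], where ‖·‖ denotes the Euclidean norm on ℝ^d. -/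
open MeasureTheory Set

open Finset in
/-- Kaluza's theorem: if `a` is positive, nonincreasing and log-convex, the reciprocal of its
generating series has positive constant coefficient, nonpositive other coefficients and nonnegative
partial sums of coefficients. -/
theorem exists_kaluza_reciprocal {a : ℕ → ℝ} (hpos : ∀ k, 0 < a k) (hanti : Antitone a)
    (hconv : ∀ k, a (k + 1) ^ 2 ≤ a k * a (k + 2)) :
    ∃ b : ℕ → ℝ, PowerSeries.mk b * PowerSeries.mk a = 1 ∧ 0 < b 0 ∧ (∀ n, b (n + 1) ≤ 0) ∧
      ∀ n, 0 ≤ ∑ p ∈ antidiagonal n, b p.1 := by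
  have hratio : Monotone fun k => a (k + 1) / a k := by
    refine monotone_nat_of_le_succ fun k => ?_
    rw [div_le_div_iff₀ (hpos _) (hpos _)]
    nlinarith [hconv k]
  obtain ⟨B, hB⟩ : ∃ B : PowerSeries ℝ, B * PowerSeries.mk a = 1 :=
    ⟨(PowerSeries.mk a)⁻¹, PowerSeries.inv_mul_cancel _ (by simpa using (hpos 0).ne')⟩
  obtain ⟨b, rfl⟩ : ∃ b, B = PowerSeries.mk b := ⟨fun n => PowerSeries.coeff n B, by ext; simp⟩
  have hcoeff (n : ℕ) : ∑ p ∈ antidiagonal n, b p.1 * a p.2 = if n = 0 then 1 else 0 := by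
    have := congrArg (PowerSeries.coeff n) hB
    simpa [PowerSeries.coeff_mul, PowerSeries.coeff_one] using this
  have hb0 : 0 < b 0 := by
    have h := hcoeff 0
    simp only [Nat.antidiagonal_zero, sum_singleton, if_true] at h
    exact pos_of_mul_pos_left (h ▸ one_pos) (hpos 0).le
  have hsucc (n : ℕ) : b 0 * a (n + 1) + ∑ p ∈ antidiagonal n, b (p.1 + 1) * a p.2 = 0 := by
    simpa [Nat.sum_antidiagonal_succ] using hcoeff (n + 1)
  have hneg (n : ℕ) : b (n + 1) ≤ 0 := by
    induction n using Nat.strong_induction_on with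
    | _ n ih =>
      rcases n with _ | m
      · have h := hsucc 0
        simp only [Nat.antidiagonal_zero, sum_singleton, zero_add] at h ⊢
        nlinarith [hpos 0, mul_pos hb0 (hpos 1)]
      · have h1 := hsucc m
        have h2 := hsucc (m + 1)
        rw [Nat.sum_antidiagonal_succ'] at h2
        simp only at h2
        have h3 : a (m + 2) / a (m + 1) * ∑ p ∈ antidiagonal m, b (p.1 + 1) * a p.2 ≤
            ∑ p ∈ antidiagonal m, b (p.1 + 1) * a (p.2 + 1) := by
          rw [mul_sum]
          refine sum_le_sum fun p hp => ?_
          rw [HasAntidiagonal.mem_antidiagonal] at hp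
          have h4 : a (p.2 + 1) ≤ a (m + 2) / a (m + 1) * a p.2 := by
            rw [← div_le_iff₀ (hpos _)]
            exact hratio (show p.2 ≤ m + 1 by omega)
          nlinarith [ih p.1 (by omega)]
        have h5 : a (m + 2) / a (m + 1) * ∑ p ∈ antidiagonal m, b (p.1 + 1) * a p.2 =
            -(b 0 * a (m + 2)) := by
          rw [eq_neg_of_add_eq_zero_right h1]
          field_simp [(hpos (m + 1)).ne']
        have h6 : b (m + 1 + 1) * a 0 ≤ 0 := by linarith
        exact nonpos_of_mul_nonpos_left h6 (hpos 0)
  refine ⟨b, hB, hb0, hneg, fun n => ?_⟩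
  rcases n with _ | n
  · simpa using hb0.le
  · rw [Nat.sum_antidiagonal_succ]
    have h : (∑ p ∈ antidiagonal n, b (p.1 + 1) * a p.2) ≤
        (∑ p ∈ antidiagonal n, b (p.1 + 1)) * a (n + 1) := by
      rw [sum_mul]
      refine sum_le_sum fun p hp => mul_le_mul_of_nonpos_left (hanti ?_) (hneg _)
      rw [HasAntidiagonal.mem_antidiagonal] at hp
      omega
    refine nonneg_of_mul_nonneg_left (b := a (n + 1)) ?_ (hpos _)
    linarith [hsucc n]

open Finset in
/-- A comparison principle for discrete Volterra equations: at the first index where `y` may exceed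
a bound `C` satisfied by the initial value and by all earlier terms, `y` exceeds it only if the
source term is negative. -/
theorem discrete_volterra_le {a : ℕ → ℝ} (hpos : ∀ k, 0 < a k) (hanti : Antitone a)
    (hconv : ∀ k, a (k + 1) ^ 2 ≤ a k * a (k + 2)) {y g : ℕ → ℝ} {y₀ C : ℝ}
    (hy : ∀ n, y n = y₀ - ∑ p ∈ antidiagonal n, a p.1 * g p.2) (hy₀ : y₀ ≤ C) {n : ℕ}
    (hC : ∀ m < n, y m ≤ C) (hg : 0 ≤ g n) : y n ≤ C := by
  obtain ⟨b, hB, hb0, hneg, hsum⟩ := exists_kaluza_reciprocal hpos hanti hconv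
  have hgn : g n = ∑ p ∈ antidiagonal n, b p.1 * (y₀ - y p.2) := by
    have h1 : PowerSeries.mk (fun n => y₀ - y n) = PowerSeries.mk a * PowerSeries.mk g := by
      ext m
      simp [PowerSeries.coeff_mul, hy m]
    have h2 : PowerSeries.mk g = PowerSeries.mk b * PowerSeries.mk (fun n => y₀ - y n) := by
      rw [h1, ← mul_assoc, hB, one_mul]
    simpa [PowerSeries.coeff_mul] using congrArg (PowerSeries.coeff n) h2
  have hmain : g n + b 0 * y n ≤ b 0 * C := by
    rcases n with _ | n
    · simp only [Nat.antidiagonal_zero, sum_singleton] at hgn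
      nlinarith
    · rw [Nat.sum_antidiagonal_succ] at hgn
      have h := hsum (n + 1)
      rw [Nat.sum_antidiagonal_succ] at h
      have h3 : ∑ p ∈ antidiagonal n, b (p.1 + 1) * (y₀ - y p.2) ≤
          (∑ p ∈ antidiagonal n, b (p.1 + 1)) * (y₀ - C) := by
        rw [sum_mul]
        refine sum_le_sum fun p hp => mul_le_mul_of_nonpos_left ?_ (hneg _)
        rw [HasAntidiagonal.mem_antidiagonal] at hp
        linarith [hC p.2 (by omega)]
      simp only at hgn h
      nlinarith
  exact le_of_mul_le_mul_left (by linarith) hb0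

section DiscreteScheme

variable {E : Type*} [NormedAddCommGroup E] [InnerProductSpace ℝ E]

/-- The sequence defined by the semi-implicit scheme
`z (n + 1) = R (f (z n)) (z₀ - ∑ j < n, a (n - j) • f (z j) • L (z (j + 1)))`. -/
noncomputable def semiImplicitSeq (a : ℕ → ℝ) (f : E → ℝ) (L : E → E) (R : ℝ → E → E) (z₀ : E) :
    ℕ → E
  | 0 => z₀
  | n + 1 => R (f (semiImplicitSeq a f L R z₀ n)) (z₀ - ∑ j : Fin n,
      a (n - j) • f (semiImplicitSeq a f L R z₀ j) • L (semiImplicitSeq a f L R z₀ (j + 1)))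

/-- A monotone linear perturbation of the identity is surjective in finite dimension. -/
theorem exists_add_smul_eq [FiniteDimensional ℝ E] {L : E →ₗ[ℝ] E}
    (hL : ∀ x, 0 ≤ inner ℝ x (L x)) {c : ℝ} (hc : 0 ≤ c) (w : E) : ∃ x, x + c • L x = w := by
  have hinj : Function.Injective ((LinearMap.id : E →ₗ[ℝ] E) + c • L) := by
    rw [← LinearMap.ker_eq_bot, LinearMap.ker_eq_bot']
    intro x hx
    have h : inner ℝ x (x + c • L x) = 0 := by
      rw [show x + c • L x = 0 from hx, inner_zero_right]
    rw [inner_add_right, real_inner_smul_right, real_inner_self_eq_norm_sq] at h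
    have := mul_nonneg hc (hL x)
    exact norm_eq_zero.1 (pow_eq_zero_iff two_ne_zero |>.1 (by nlinarith [sq_nonneg ‖x‖]))
  exact LinearMap.injective_iff_surjective.1 hinj w

open Finset in
/-- Discrete Volterra equations with a positive, nonincreasing, log-convex kernel and a monotone
right-hand side have a solution bounded by its initial value. -/
theorem exists_discrete_volterra [FiniteDimensional ℝ E] {a : ℕ → ℝ} (hpos : ∀ k, 0 < a k)
    (hanti : Antitone a) (hconv : ∀ k, a (k + 1) ^ 2 ≤ a k * a (k + 2)) {L : E →ₗ[ℝ] E}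
    (hL : ∀ x, 0 ≤ inner ℝ x (L x)) {f : E → ℝ} (hf : ∀ x, 0 ≤ f x) (z₀ : E) :
    ∃ z : ℕ → E, z 0 = z₀ ∧
      (∀ n, z (n + 1) = z₀ - ∑ j ∈ range (n + 1), a (n - j) • f (z j) • L (z (j + 1))) ∧
      ∀ n, ‖z n‖ ≤ ‖z₀‖ := by
  have hsolve (c : ℝ) (w : E) : ∃ x, 0 ≤ c → x + (a 0 * c) • L x = w := by
    by_cases hc : 0 ≤ c
    · obtain ⟨x, hx⟩ := exists_add_smul_eq hL (mul_nonneg (hpos 0).le hc) w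
      exact ⟨x, fun _ => hx⟩
    · exact ⟨0, fun h => absurd h hc⟩
  choose R hR using hsolve
  obtain ⟨z, hz⟩ : ∃ z, z = semiImplicitSeq a f L R z₀ := ⟨_, rfl⟩
  have hz0 : z 0 = z₀ := by rw [hz, semiImplicitSeq]
  have hstep (n : ℕ) :
      z (n + 1) = z₀ - ∑ j ∈ range (n + 1), a (n - j) • f (z j) • L (z (j + 1)) := by
    have h := hR (f (z n)) (z₀ - ∑ j : Fin n, a (n - j) • f (z j) • L (z (j + 1))) (hf _)
    have h' : z (n + 1) = R (f (z n)) (z₀ - ∑ j : Fin n, a (n - j) • f (z j) • L (z (j + 1))) := by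
      rw [hz, semiImplicitSeq]
    rw [← h', Fin.sum_univ_eq_sum_range (fun j => a (n - j) • f (z j) • L (z (j + 1))) n] at h
    rw [sum_range_succ, Nat.sub_self, smul_smul, ← sub_sub, ← h, add_sub_cancel_right]
  refine ⟨z, hz0, hstep, fun n => ?_⟩
  induction n using Nat.strong_induction_on with
  | _ n ih =>
    rcases n with _ | n
    · rw [hz0]
    · have hle := discrete_volterra_le (y := fun m => inner ℝ (z (n + 1)) (z (m + 1)))
        (g := fun m => inner ℝ (z (n + 1)) (f (z m) • L (z (m + 1))))
        (y₀ := inner ℝ (z (n + 1)) z₀) (C := ‖z (n + 1)‖ * ‖z₀‖) (n := n) hpos hanti hconv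
        (fun m => by
          rw [hstep m, inner_sub_right, inner_sum, Nat.antidiagonal_eq_map', sum_map]
          simp only [real_inner_smul_right]
          rfl)
        (real_inner_le_norm _ _)
        (fun m hm => (real_inner_le_norm _ _).trans
          (mul_le_mul_of_nonneg_left (ih (m + 1) (by omega)) (norm_nonneg _)))
        (by
          rw [real_inner_smul_right]
          exact mul_nonneg (hf _) (hL _))
      simp only [real_inner_self_eq_norm_sq] at hle
      by_contra! hlt
      nlinarith [norm_nonneg z₀]

end DiscreteScheme

section PowerWeights

variable {α : ℝ}

theorem rpow_add_one_sub_rpow_pos (hα : 0 < α) (k : ℕ) : 0 < ((k : ℝ) + 1) ^ α - (k : ℝ) ^ α :=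
  sub_pos.2 (Real.rpow_lt_rpow k.cast_nonneg (lt_add_one _) hα)

theorem antitone_rpow_add_one_sub_rpow (hα : 0 < α) (hα1 : α < 1) :
    Antitone fun k : ℕ => ((k : ℝ) + 1) ^ α - (k : ℝ) ^ α := by
  refine antitone_nat_of_succ_le fun k => ?_
  have h := (Real.concaveOn_rpow hα.le hα1.le).2 (show (0 : ℝ) ≤ k by positivity)
    (show (0 : ℝ) ≤ (k : ℝ) + 2 by positivity) (show (0 : ℝ) ≤ 1 / 2 by norm_num)
    (show (0 : ℝ) ≤ 1 / 2 by norm_num) (by norm_num)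
  simp only [smul_eq_mul] at h
  rw [show 1 / 2 * (k : ℝ) + 1 / 2 * ((k : ℝ) + 2) = k + 1 by ring] at h
  push_cast
  rw [show (k : ℝ) + 1 + 1 = k + 2 by ring]
  linarith

theorem sq_rpow_add_one_sub_rpow_le (hα : 0 < α) (hα1 : α < 1) (k : ℕ) :
    ((((k + 1 : ℕ) : ℝ) + 1) ^ α - ((k + 1 : ℕ) : ℝ) ^ α) ^ 2 ≤
      (((k : ℝ) + 1) ^ α - (k : ℝ) ^ α) *
        ((((k + 2 : ℕ) : ℝ) + 1) ^ α - ((k + 2 : ℕ) : ℝ) ^ α) := by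
  have key (l : ℝ) (hl : 0 < l) :
      MonotoneOn (fun x : ℝ => l * x ^ α + l⁻¹ * (x + 2) ^ α - 2 * (x + 1) ^ α) (Ici 0) := by
    have hc (c : ℝ) : Continuous fun x : ℝ => (x + c) ^ α :=
      (continuous_id.add continuous_const).rpow_const fun _ => Or.inr hα.le
    have hd (x c : ℝ) (hx : 0 < x) (hc : 0 ≤ c) :
        HasDerivAt (fun x : ℝ => (x + c) ^ α) (α * (x + c) ^ (α - 1)) x := by
      simpa using ((hasDerivAt_id x).add_const c).rpow_const (p := α)
        (Or.inl (show x + c ≠ 0 by positivity))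
    have hD (x : ℝ) (hx : 0 < x) :
        HasDerivAt (fun x : ℝ => l * x ^ α + l⁻¹ * (x + 2) ^ α - 2 * (x + 1) ^ α)
          (l * (α * x ^ (α - 1)) + l⁻¹ * (α * (x + 2) ^ (α - 1)) -
            2 * (α * (x + 1) ^ (α - 1))) x := by
      have h0 := hd x 0 hx le_rfl
      simp only [add_zero] at h0
      exact ((h0.const_mul l).add ((hd x 2 hx zero_le_two).const_mul l⁻¹)).sub
        ((hd x 1 hx zero_le_one).const_mul 2)
    refine monotoneOn_of_deriv_nonneg (convex_Ici 0) ?_ ?_ ?_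
    · have h0 := hc 0
      simp only [add_zero] at h0
      exact (((h0.const_mul l).add ((hc 2).const_mul l⁻¹)).sub ((hc 1).const_mul 2)).continuousOn
    · rw [interior_Ici]
      exact fun x hx => (hD x hx).differentiableAt.differentiableWithinAt
    · rw [interior_Ici]
      intro x hx
      rw [mem_Ioi] at hx
      rw [(hD x hx).deriv]
      have hsq : ((x + 1) ^ (α - 1)) ^ 2 ≤ x ^ (α - 1) * (x + 2) ^ (α - 1) := by
        rw [← Real.mul_rpow hx.le (by positivity), sq,
          ← Real.mul_rpow (by positivity) (by positivity)]
        exact Real.rpow_le_rpow_of_nonpos (by positivity) (by nlinarith) (by linarith)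
      have hp : 0 < x ^ (α - 1) := by positivity
      have hq : 0 < (x + 2) ^ (α - 1) := by positivity
      have hr : 0 < (x + 1) ^ (α - 1) := by positivity
      generalize x ^ (α - 1) = p at *
      generalize (x + 2) ^ (α - 1) = q at *
      generalize (x + 1) ^ (α - 1) = r at *
      have h2 : 2 * r ≤ l * p + l⁻¹ * q := by
        refine le_of_sq_le_sq ?_ (by positivity)
        have h3 : l * p * (l⁻¹ * q) = p * q := by field_simp
        nlinarith [sq_nonneg (l * p - l⁻¹ * q)]
      nlinarith
  have h0 := rpow_add_one_sub_rpow_pos hα k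
  have h1 := rpow_add_one_sub_rpow_pos hα (k + 1)
  have hk := key _ (div_pos h1 h0) (show (0 : ℝ) ≤ k by positivity)
    (show (0 : ℝ) ≤ (k : ℝ) + 1 by positivity) (by linarith)
  push_cast at *
  rw [show (k : ℝ) + 1 + 1 = k + 2 by ring] at *
  rw [show (k : ℝ) + 1 + 2 = k + 2 + 1 by ring] at *
  set p := ((k : ℝ) + 1) ^ α - (k : ℝ) ^ α
  set q := ((k : ℝ) + 2) ^ α - ((k : ℝ) + 1) ^ α
  set r := ((k : ℝ) + 2 + 1) ^ α - ((k : ℝ) + 2) ^ α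
  have h3 : 2 * q ≤ q / p * p + (q / p)⁻¹ * r := by
    simp only [p, q, r] at hk ⊢
    linarith
  rw [div_mul_cancel₀ _ h0.ne', inv_div, div_mul_eq_mul_div] at h3
  have h4 : q ≤ p * r / q := by linarith
  rw [le_div_iff₀ h1] at h4
  linarith

end PowerWeights

section FractionalIntegral

variable {α : ℝ} {E : Type*} [NormedAddCommGroup E] [NormedSpace ℝ E]

theorem intervalIntegrable_sub_rpow (hα : 0 < α) (t a b : ℝ) :
    IntervalIntegrable (fun s => (t - s) ^ (α - 1)) volume a b := by
  have h := (intervalIntegral.intervalIntegrable_rpow' (a := t - a) (b := t - b)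
    (show -1 < α - 1 by linarith)).comp_sub_left t
  simpa using h

theorem integral_sub_rpow (hα : 0 < α) (t a b : ℝ) :
    ∫ s in a..b, (t - s) ^ (α - 1) = ((t - a) ^ α - (t - b) ^ α) / α := by
  rw [intervalIntegral.integral_comp_sub_left (fun x => x ^ (α - 1)),
    integral_rpow (Or.inl (by linarith)), sub_add_cancel]

theorem IntervalIntegrable.smul_of_norm_le {k : ℝ → ℝ} {G : ℝ → E} {M a b : ℝ}
    (hk : IntervalIntegrable k volume a b) (hG : AEStronglyMeasurable G) (hM : ∀ s, ‖G s‖ ≤ M) :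
    IntervalIntegrable (fun s => k s • G s) volume a b := by
  refine (hk.const_mul M).mono_fun
    (hk.aestronglyMeasurable_restrict_uIoc.smul hG.restrict) (ae_of_all _ fun s => ?_)
  simp only [norm_smul, norm_mul, mul_comm ‖M‖]
  exact mul_le_mul_of_nonneg_left ((hM s).trans (le_abs_self M)) (norm_nonneg _)

theorem norm_integral_sub_rpow_smul_sub_le (hα : 0 < α) (hα1 : α < 1) {G : ℝ → E} {M : ℝ}
    (hG : AEStronglyMeasurable G) (hM : ∀ s, ‖G s‖ ≤ M) {s t : ℝ} (hs : 0 ≤ s) (hst : s ≤ t) :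
    ‖(∫ r in (0 : ℝ)..t, (t - r) ^ (α - 1) • G r) - ∫ r in (0 : ℝ)..s, (s - r) ^ (α - 1) • G r‖ ≤
      2 * M / α * (t - s) ^ α := by
  have hM0 : 0 ≤ M := (norm_nonneg _).trans (hM 0)
  have hk := intervalIntegrable_sub_rpow hα
  have hkG (u a b : ℝ) : IntervalIntegrable (fun r => (u - r) ^ (α - 1) • G r) volume a b :=
    (hk u a b).smul_of_norm_le hG hM
  have hsplit : (∫ r in (0 : ℝ)..t, (t - r) ^ (α - 1) • G r) -
      ∫ r in (0 : ℝ)..s, (s - r) ^ (α - 1) • G r =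
      -(∫ r in (0 : ℝ)..s, ((s - r) ^ (α - 1) - (t - r) ^ (α - 1)) • G r) +
        ∫ r in s..t, (t - r) ^ (α - 1) • G r := by
    rw [← intervalIntegral.integral_add_adjacent_intervals (hkG t 0 s) (hkG t s t)]
    simp only [sub_smul]
    rw [intervalIntegral.integral_sub (hkG s 0 s) (hkG t 0 s)]
    abel
  have h1 : ‖∫ r in (0 : ℝ)..s, ((s - r) ^ (α - 1) - (t - r) ^ (α - 1)) • G r‖ ≤
      ∫ r in (0 : ℝ)..s, ((s - r) ^ (α - 1) - (t - r) ^ (α - 1)) * M := by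
    refine intervalIntegral.norm_integral_le_of_norm_le hs ?_
      (((hk s 0 s).sub (hk t 0 s)).mul_const M)
    filter_upwards [Measure.ae_ne volume s] with r hrs hr
    have hrs' : r < s := lt_of_le_of_ne hr.2 hrs
    rw [norm_smul, Real.norm_of_nonneg]
    · refine mul_le_mul_of_nonneg_left (hM r) (sub_nonneg.2 ?_)
      exact Real.rpow_le_rpow_of_nonpos (by linarith) (by linarith) (by linarith)
    · rw [sub_nonneg]
      exact Real.rpow_le_rpow_of_nonpos (by linarith) (by linarith) (by linarith)
  have h2 : ‖∫ r in s..t, (t - r) ^ (α - 1) • G r‖ ≤ ∫ r in s..t, (t - r) ^ (α - 1) * M := by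
    refine intervalIntegral.norm_integral_le_of_norm_le hst (ae_of_all _ fun r hr => ?_)
      ((hk t s t).mul_const M)
    have h : 0 ≤ (t - r) ^ (α - 1) := Real.rpow_nonneg (sub_nonneg.2 hr.2) _
    rw [norm_smul, Real.norm_of_nonneg h]
    exact mul_le_mul_of_nonneg_left (hM r) h
  rw [intervalIntegral.integral_mul_const, intervalIntegral.integral_sub (hk s 0 s) (hk t 0 s),
    integral_sub_rpow hα, integral_sub_rpow hα] at h1
  rw [intervalIntegral.integral_mul_const, integral_sub_rpow hα] at h2
  simp only [sub_self, sub_zero, Real.zero_rpow hα.ne'] at h1 h2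
  rw [hsplit]
  refine (norm_add_le _ _).trans ?_
  rw [norm_neg]
  have h3 : s ^ α ≤ t ^ α := Real.rpow_le_rpow hs hst hα.le
  have h4 : (s ^ α / α - (t ^ α - (t - s) ^ α) / α) * M ≤ (t - s) ^ α / α * M := by
    refine mul_le_mul_of_nonneg_right ?_ hM0
    rw [← sub_div]
    exact div_le_div_of_nonneg_right (by linarith) hα.le
  calc _ ≤ (t - s) ^ α / α * M + (t - s) ^ α / α * M := add_le_add (h1.trans h4) h2
    _ = _ := by ring

open Finset in
theorem integral_sub_rpow_smul_step [CompleteSpace E] (hα : 0 < α) {h M : ℝ} (hh : 0 < h)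
    {g : ℕ → E} (hM : ∀ n, ‖g n‖ ≤ M) (n : ℕ) :
    ∫ s in (0 : ℝ)..n * h, (n * h - s) ^ (α - 1) • g ⌊s / h⌋₊ =
      ∑ j ∈ range n, (h ^ α / α * (((n : ℝ) - j) ^ α - ((n : ℝ) - j - 1) ^ α)) • g j := by
  have hG : AEStronglyMeasurable fun s : ℝ => g ⌊s / h⌋₊ :=
    (StronglyMeasurable.of_discrete.comp_measurable
      (Nat.measurable_floor.comp (measurable_id.div_const h))).aestronglyMeasurable
  have hint (a b : ℝ) :
      IntervalIntegrable (fun s => ((n : ℝ) * h - s) ^ (α - 1) • g ⌊s / h⌋₊) volume a b :=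
    (intervalIntegrable_sub_rpow hα _ a b).smul_of_norm_le hG fun s => hM _
  have hsum := intervalIntegral.sum_integral_adjacent_intervals (a := fun j : ℕ => (j : ℝ) * h)
    (n := n) fun k _ => hint (k * h) ((k + 1 : ℕ) * h)
  simp only [Nat.cast_zero, zero_mul] at hsum
  rw [← hsum]
  refine sum_congr rfl fun j hj => ?_
  have hjn : (j : ℝ) + 1 ≤ n := by exact_mod_cast mem_range.1 hj
  have hle : (j : ℝ) * h ≤ ((j + 1 : ℕ) : ℝ) * h := by
    push_cast
    nlinarith
  have hcongr : ∫ s in (j : ℝ) * h..((j + 1 : ℕ) : ℝ) * h,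
      ((n : ℝ) * h - s) ^ (α - 1) • g ⌊s / h⌋₊ =
      ∫ s in (j : ℝ) * h..((j + 1 : ℕ) : ℝ) * h, ((n : ℝ) * h - s) ^ (α - 1) • g j := by
    refine intervalIntegral.integral_congr_ae ?_
    filter_upwards [Measure.ae_ne volume (((j + 1 : ℕ) : ℝ) * h)] with s hs hs'
    rw [uIoc_of_le hle] at hs'
    have hlt : s < ((j + 1 : ℕ) : ℝ) * h := lt_of_le_of_ne hs'.2 hs
    have hs0 : 0 ≤ s := le_trans (by positivity) hs'.1.le
    have hfl : ⌊s / h⌋₊ = j := by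
      rw [Nat.floor_eq_iff (by positivity), le_div_iff₀ hh, div_lt_iff₀ hh]
      exact ⟨hs'.1.le, by exact_mod_cast hlt⟩
    rw [hfl]
  rw [hcongr, intervalIntegral.integral_smul_const, integral_sub_rpow hα]
  congr 1
  rw [show (n : ℝ) * h - j * h = h * (n - j) by ring,
    show (n : ℝ) * h - ((j + 1 : ℕ) : ℝ) * h = h * (n - j - 1) by push_cast; ring,
    Real.mul_rpow hh.le (by linarith), Real.mul_rpow hh.le (by linarith)]
  ring

end FractionalIntegral

section Compactness

open Filter Topology

/-- Arzelà–Ascoli for a sequence of functions that is uniformly Hölder on a compact interval. -/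
theorem exists_subseq_tendsto_of_holder {E : Type*} [NormedAddCommGroup E] [ProperSpace E]
    {T C α : ℝ} (hT : 0 ≤ T) (hα : 0 < α) {Z : ℕ → ℝ → E} {z₀ : E} (h0 : ∀ n, Z n 0 = z₀)
    (hZ : ∀ n, ∀ s ∈ Icc 0 T, ∀ t ∈ Icc 0 T, dist (Z n s) (Z n t) ≤ C * |s - t| ^ α) :
    ∃ z : ℝ → E, Continuous z ∧ ∃ ψ : ℕ → ℕ, StrictMono ψ ∧
      ∀ t ∈ Icc 0 T, Tendsto (fun k => Z (ψ k) t) atTop (𝓝 (z t)) := by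
  have hmod : Tendsto (fun r : ℝ => C * |r| ^ α) (𝓝 0) (𝓝 0) := by
    have h : Continuous fun r : ℝ => C * |r| ^ α :=
      continuous_const.mul (continuous_abs.rpow_const fun _ => Or.inr hα.le)
    simpa [Real.zero_rpow hα.ne'] using h.tendsto 0
  have hdist (n : ℕ) (s t : Icc (0 : ℝ) T) : dist (Z n s) (Z n t) ≤ C * |dist s t| ^ α := by
    rw [abs_of_nonneg dist_nonneg, Subtype.dist_eq, Real.dist_eq]
    exact hZ n s s.2 t t.2
  have hcont (n : ℕ) : Continuous fun s : Icc (0 : ℝ) T => Z n s :=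
    (Metric.equicontinuous_of_continuity_modulus (fun r : ℝ => C * |r| ^ α) hmod
      (fun n (s : Icc (0 : ℝ) T) => Z n s) fun s t n => hdist n s t).continuous n
  let F (n : ℕ) : BoundedContinuousFunction (Icc (0 : ℝ) T) E :=
    BoundedContinuousFunction.mkOfCompact ⟨_, hcont n⟩
  have hcompact : IsCompact (closure (range F)) := by
    refine BoundedContinuousFunction.arzela_ascoli (Metric.closedBall z₀ (|C| * T ^ α))
      (isCompact_closedBall _ _) _ ?_ ?_
    · rintro _ t ⟨n, rfl⟩
      have h := hZ n t t.2 0 ⟨le_rfl, hT⟩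
      rw [h0, sub_zero, abs_of_nonneg t.2.1] at h
      refine Metric.mem_closedBall.2 (h.trans (mul_le_mul (le_abs_self C) ?_ ?_ (abs_nonneg C)))
      · exact Real.rpow_le_rpow t.2.1 t.2.2 hα.le
      · exact Real.rpow_nonneg t.2.1 _
    · refine Metric.equicontinuous_of_continuity_modulus (fun r : ℝ => C * |r| ^ α) hmod _ ?_
      rintro s t ⟨_, n, rfl⟩
      exact hdist n s t
  obtain ⟨z, -, ψ, hψ, hlim⟩ := hcompact.tendsto_subseq fun n => subset_closure (mem_range_self n)
  refine ⟨IccExtend hT z, z.continuous.Icc_extend', ψ, hψ, fun t ht => ?_⟩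
  rw [IccExtend_of_mem hT z ht]
  have heval := continuous_eval_const (F := BoundedContinuousFunction (Icc (0 : ℝ) T) E) ⟨t, ht⟩
  exact (heval.tendsto z).comp hlim

end Compactness

section FractionalVolterra

open Filter Topology

variable {E : Type*} [NormedAddCommGroup E] [InnerProductSpace ℝ E] [FiniteDimensional ℝ E]

/-- Piecewise constant approximation of the Volterra equation with step `h`: the nonlinearity is
evaluated at grid values `w n`, which are the values at `n * h` of the continuous interpolant given
by the right-hand side of the equation. -/
theorem exists_volterra_approx {α h : ℝ} (hα : 0 < α) (hα1 : α < 1) (hh : 0 < h) {L : E →ₗ[ℝ] E}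
    (hL : ∀ x, 0 ≤ inner ℝ x (L x)) {f : E → ℝ} (hf : ∀ x, 0 ≤ f x) {M : ℝ} {z₀ : E}
    (hM : ∀ x y, ‖x‖ ≤ ‖z₀‖ → ‖y‖ ≤ ‖z₀‖ → ‖f x • L y‖ ≤ M) :
    ∃ w : ℕ → E, (∀ n, ‖w n‖ ≤ ‖z₀‖) ∧ ∀ n : ℕ, w n = z₀ - (1 / Real.Gamma α) •
      ∫ s in (0 : ℝ)..n * h, (n * h - s) ^ (α - 1) • f (w ⌊s / h⌋₊) • L (w (⌊s / h⌋₊ + 1)) := by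
  have hc : 0 < h ^ α / (α * Real.Gamma α) := by
    have := Real.Gamma_pos_of_pos hα
    positivity
  obtain ⟨w, hw0, hw, hwn⟩ := exists_discrete_volterra
    (a := fun k => h ^ α / (α * Real.Gamma α) * (((k : ℝ) + 1) ^ α - (k : ℝ) ^ α))
    (fun k => mul_pos hc (rpow_add_one_sub_rpow_pos hα k))
    (fun k l hkl => mul_le_mul_of_nonneg_left (antitone_rpow_add_one_sub_rpow hα hα1 hkl) hc.le)
    (fun k => by
      have h1 := mul_le_mul_of_nonneg_left (sq_rpow_add_one_sub_rpow_le hα hα1 k)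
        (sq_nonneg (h ^ α / (α * Real.Gamma α)))
      calc _ = _ := mul_pow _ _ _
        _ ≤ _ := h1
        _ = _ := by ring)
    hL hf z₀
  refine ⟨w, hwn, fun n => ?_⟩
  rw [integral_sub_rpow_smul_step hα hh (g := fun j => f (w j) • L (w (j + 1)))
    (fun j => hM _ _ (hwn _) (hwn _)), Finset.smul_sum]
  rcases n with _ | n
  · simp [hw0]
  · rw [hw n]
    congr 1
    refine Finset.sum_congr rfl fun j hj => ?_
    have hjn : j ≤ n := Nat.lt_succ_iff.1 (Finset.mem_range.1 hj)
    rw [smul_smul (1 / Real.Gamma α)]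
    congr 1
    push_cast [Nat.cast_sub hjn]
    rw [show (n : ℝ) + 1 - j - 1 = n - j by ring, show (n : ℝ) + 1 - j = n - j + 1 by ring]
    field_simp

/-- Existence of a norm-nonincreasing solution of the fractional Volterra equation with a linear
monotone operator and a continuous nonnegative scalar nonlinearity. -/
theorem exists_fractional_volterra_solution {α T : ℝ} (hα : 0 < α) (hα1 : α < 1) (hT : 0 ≤ T)
    {L : E →ₗ[ℝ] E} (hL : ∀ x, 0 ≤ inner ℝ x (L x)) {f : E → ℝ} (hf : Continuous f)
    (hf0 : ∀ x, 0 ≤ f x) (z₀ : E) :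
    ∃ z : ℝ → E, Continuous z ∧
      (∀ t ∈ Icc (0 : ℝ) T, z t = z₀ - (1 / Real.Gamma α) •
        ∫ s in (0 : ℝ)..t, (t - s) ^ (α - 1) • f (z s) • L (z s)) ∧
      ∀ t ∈ Icc (0 : ℝ) T, ‖z t‖ ≤ ‖z₀‖ := by
  have hLc : Continuous L := L.continuous_of_finiteDimensional
  obtain ⟨M, hM⟩ : ∃ M, ∀ x y, ‖x‖ ≤ ‖z₀‖ → ‖y‖ ≤ ‖z₀‖ → ‖f x • L y‖ ≤ M := by
    have hK := isCompact_closedBall (0 : E) ‖z₀‖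
    obtain ⟨M, hM⟩ := (hK.prod hK).exists_bound_of_continuousOn
      (f := fun p : E × E => f p.1 • L p.2)
      ((hf.comp continuous_fst).smul (hLc.comp continuous_snd)).continuousOn
    exact ⟨M, fun x y hx hy => hM (x, y) ⟨by simpa using hx, by simpa using hy⟩⟩
  have hΓ := Real.Gamma_pos_of_pos hα
  have hstep (N : ℕ) : 0 < 1 / ((N : ℝ) + 1) := Nat.one_div_pos_of_nat
  choose w hwn hw using fun N : ℕ => exists_volterra_approx hα hα1 (hstep N) hL hf0 hM
  let η (N : ℕ) : ℝ := 1 / ((N : ℝ) + 1)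
  let G (N : ℕ) (s : ℝ) : E := f (w N ⌊s / η N⌋₊) • L (w N (⌊s / η N⌋₊ + 1))
  let Z (N : ℕ) (t : ℝ) : E :=
    z₀ - (1 / Real.Gamma α) • ∫ s in (0 : ℝ)..t, (t - s) ^ (α - 1) • G N s
  have hη (N : ℕ) : 0 < η N := hstep N
  have hZw (N n : ℕ) : w N n = Z N (n * η N) := hw N n
  have hGM (N : ℕ) (s : ℝ) : ‖G N s‖ ≤ M := hM _ _ (hwn _ _) (hwn _ _)
  have hG (N : ℕ) : AEStronglyMeasurable (G N) := by
    have h : StronglyMeasurable fun n : ℕ => f (w N n) • L (w N (n + 1)) :=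
      StronglyMeasurable.of_discrete
    exact (h.comp_measurable
      (Nat.measurable_floor.comp (measurable_id.div_const (η N)))).aestronglyMeasurable
  obtain ⟨C, hC⟩ : ∃ C, ∀ N, ∀ s t, 0 ≤ s → 0 ≤ t → dist (Z N s) (Z N t) ≤ C * |s - t| ^ α := by
    refine ⟨1 / Real.Gamma α * (2 * M / α), fun N s t hs ht => ?_⟩
    wlog hst : s ≤ t generalizing s t
    · rw [dist_comm, abs_sub_comm]
      exact this t s ht hs (le_of_not_ge hst)
    have h := norm_integral_sub_rpow_smul_sub_le hα hα1 (hG N) (hGM N) hs hst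
    rw [dist_eq_norm, sub_sub_sub_cancel_left, ← smul_sub, norm_smul,
      Real.norm_of_nonneg (by positivity), abs_sub_comm, abs_of_nonneg (sub_nonneg.2 hst), mul_assoc]
    exact mul_le_mul_of_nonneg_left h (by positivity)
  obtain ⟨z, hz, ψ, hψ, hlim⟩ := exists_subseq_tendsto_of_holder hT hα (Z := Z) (z₀ := z₀)
    (fun N => by simp [Z]) fun N s hs t ht => hC N s t hs.1 ht.1
  have hη0 : Tendsto (fun k => C * η (ψ k) ^ α) atTop (𝓝 0) := by
    have h := (tendsto_one_div_add_atTop_nhds_zero_nat (𝕜 := ℝ)).comp hψ.tendsto_atTop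
    simpa [Real.zero_rpow hα.ne', η] using
      ((h.rpow_const (Or.inr hα.le)).const_mul C : Tendsto _ _ (𝓝 (C * 0 ^ α)))
  have hC0 : 0 ≤ C := by
    have h := dist_nonneg.trans (hC 0 1 0 zero_le_one le_rfl)
    simpa using h
  have hgrid {t : ℝ} (ht : t ∈ Icc 0 T) {m : ℕ → ℕ} (hm : ∀ k, |m k * η (ψ k) - t| ≤ η (ψ k)) :
      Tendsto (fun k => w (ψ k) (m k)) atTop (𝓝 (z t)) := by
    refine tendsto_of_tendsto_of_dist (hlim t ht) (squeeze_zero (fun _ => dist_nonneg)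
      (fun k => ?_) hη0)
    rw [hZw, dist_comm]
    refine (hC _ _ _ (mul_nonneg (Nat.cast_nonneg _) (hη _).le) ht.1).trans ?_
    exact mul_le_mul_of_nonneg_left (Real.rpow_le_rpow (abs_nonneg _) (hm k) hα.le) hC0
  have hfloor {t : ℝ} (ht : t ∈ Icc 0 T) (k : ℕ) :
      (⌊t / η (ψ k)⌋₊ : ℝ) * η (ψ k) ≤ t ∧ t < (⌊t / η (ψ k)⌋₊ + 1 : ℝ) * η (ψ k) :=
    ⟨(le_div_iff₀ (hη _)).1 (Nat.floor_le (div_nonneg ht.1 (hη _).le)),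
      (div_lt_iff₀ (hη _)).1 (Nat.lt_floor_add_one _)⟩
  have hleft {t : ℝ} (ht : t ∈ Icc 0 T) :
      Tendsto (fun k => w (ψ k) ⌊t / η (ψ k)⌋₊) atTop (𝓝 (z t)) := by
    refine hgrid ht fun k => abs_le.2 ?_
    have := hfloor ht k
    constructor <;> linarith [hη (ψ k)]
  have hright {t : ℝ} (ht : t ∈ Icc 0 T) :
      Tendsto (fun k => w (ψ k) (⌊t / η (ψ k)⌋₊ + 1)) atTop (𝓝 (z t)) := by
    refine hgrid ht fun k => abs_le.2 ?_
    have := hfloor ht k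
    push_cast
    constructor <;> linarith [hη (ψ k)]
  refine ⟨z, hz, fun t ht => ?_, fun t ht => ?_⟩
  · refine tendsto_nhds_unique (hlim t ht) (Tendsto.const_sub z₀ (Tendsto.const_smul ?_ _))
    have hk := intervalIntegrable_sub_rpow hα t 0 t
    refine intervalIntegral.tendsto_integral_filter_of_dominated_convergence
      (fun s => ‖(t - s) ^ (α - 1)‖ * M) (Eventually.of_forall fun k => ?_)
      (Eventually.of_forall fun k => ae_of_all _ fun s _ => ?_) (hk.norm.mul_const M)
      (ae_of_all _ fun s hs => ?_)
    · exact hk.aestronglyMeasurable_restrict_uIoc.smul (hG _).restrict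
    · rw [norm_smul]
      exact mul_le_mul_of_nonneg_left (hGM _ _) (norm_nonneg _)
    · rw [uIoc_of_le ht.1] at hs
      have hsT : s ∈ Icc 0 T := ⟨hs.1.le, hs.2.trans ht.2⟩
      exact ((((hf.tendsto _).comp (hleft hsT)).smul
        ((hLc.tendsto _).comp (hright hsT))).const_smul _)
  · exact le_of_tendsto (hleft ht).norm (Eventually.of_forall fun k => hwn _ _)

end FractionalVolterra

/-- Existence of a continuous solution of the Volterra integral formulation of
`{}_0^C D_t^α z = -A f(z) z`, `z(0) = z₀`, with `A` symmetric positive semidefinite and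
`f ≥ 0` continuous; moreover the solution satisfies `‖z(t)‖ ≤ ‖z₀‖`. -/
theorem nonlinear_fractional_existence_and_bound
    (d : ℕ) (α : ℝ) (hα : α ∈ Set.Ioo (0:ℝ) 1)
    (A : Matrix (Fin d) (Fin d) ℝ) (hA : A.PosSemidef)
    (f : EuclideanSpace ℝ (Fin d) → ℝ) (hf : Continuous f) (hfnn : ∀ y, 0 ≤ f y)
    (T : ℝ) (hT : 0 < T) (z₀ : EuclideanSpace ℝ (Fin d)) :
    ∃ z : ℝ → EuclideanSpace ℝ (Fin d),
      ContinuousOn z (Set.Icc 0 T) ∧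
      (∀ t ∈ Set.Icc (0:ℝ) T,
        z t = z₀ - (1 / Real.Gamma α) •
          ∫ s in (0:ℝ)..t, (t - s) ^ (α - 1) • (f (z s) • Matrix.toEuclideanLin A (z s))) ∧
      (∀ t ∈ Set.Icc (0:ℝ) T, ‖z t‖ ≤ ‖z₀‖) := by
  have hpos := Matrix.isPositive_toEuclideanLin_iff.2 hA
  obtain ⟨z, hz, hsol, hbound⟩ := exists_fractional_volterra_solution hα.1 hα.2 hT.le
    (fun x => hpos.inner_nonneg_right x) hf hfnn z₀
  exact ⟨z, hz.continuousOn, hsol, hbound⟩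
end

section
/- Let α ∈ (0,1), let A be a real symmetric positive semidefinite d×d matrix, let f : ℝ^d → ℝ be continuous with f(y) ≥ 0 for all y, and assume in addition that the map F(z) = f(z)·z is continuously differentiable on ℝ^d. Let T > 0 and z₀ ∈ ℝ^d. If z₁, z₂ : [0,T] → ℝ^d are continuous and both satisfy z_i(t) = z₀ − (1/Γ(α)) ∫₀^t (t−s)^{α−1} f(z_i(s))·(A z_i(s)) ds for every t ∈ [0,T], then z₁ = z₂ on [0,T]. -/
open MeasureTheory Set

lemma intervalIntegrable_abel_kernel {α : ℝ} (hα : 0 < α) (t : ℝ) :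
    IntervalIntegrable (fun s : ℝ => (t - s) ^ (α - 1)) volume 0 t := by
  have h : IntervalIntegrable (fun s : ℝ => s ^ (α - 1)) volume 0 t :=
    intervalIntegral.intervalIntegrable_rpow' (by linarith)
  simpa using (h.comp_sub_left t).symm

lemma integral_abel_kernel_mul_exp_le {α r t : ℝ} (hα : 0 < α) (hr : 0 < r) (ht : 0 ≤ t) :
    ∫ s in (0:ℝ)..t, (t - s) ^ (α - 1) * Real.exp (-(r * (t - s))) ≤
      (1 / r) ^ α * Real.Gamma α := by
  have hint : IntegrableOn (fun x : ℝ => x ^ (α - 1) * Real.exp (-(r * x))) (Ioi 0) := by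
    simpa using integrableOn_rpow_mul_exp_neg_mul_rpow (s := α - 1) (by linarith) one_pos hr
  rw [intervalIntegral.integral_comp_sub_left
    (fun x : ℝ => x ^ (α - 1) * Real.exp (-(r * x))), sub_self, sub_zero,
    intervalIntegral.integral_of_le ht, ← Real.integral_rpow_mul_exp_neg_mul_Ioi hα hr]
  refine setIntegral_mono_set hint ?_ Ioc_subset_Ioi_self.eventuallyLE
  filter_upwards [ae_restrict_mem measurableSet_Ioi] with x hx
  have : (0:ℝ) < x := hx
  simp only [Pi.zero_apply]
  positivity

/-- A homogeneous Gronwall inequality for the weakly singular kernel `(t - s) ^ (α - 1)`. -/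
lemma nonpos_of_le_integral_abel_kernel {α C T : ℝ} (hα : 0 < α) (hC : 0 ≤ C) {w : ℝ → ℝ}
    (hwc : ContinuousOn w (Icc 0 T))
    (hw : ∀ t ∈ Icc (0:ℝ) T, w t ≤ C * ∫ s in (0:ℝ)..t, (t - s) ^ (α - 1) * w s) :
    ∀ t ∈ Icc (0:ℝ) T, w t ≤ 0 := by
  obtain ⟨r, hr, hrC⟩ : ∃ r : ℝ, 0 < r ∧ C * ((1 / r) ^ α * Real.Gamma α) < 1 := by
    have h : Filter.Tendsto (fun r : ℝ => C * (r ^ (-α) * Real.Gamma α)) Filter.atTop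
        (nhds (C * (0 * Real.Gamma α))) :=
      ((tendsto_rpow_neg_atTop hα).mul_const _).const_mul _
    simp only [zero_mul, mul_zero] at h
    obtain ⟨r, h1, h0⟩ :=
      ((h.eventually_lt_const one_pos).and (Filter.eventually_gt_atTop 0)).exists
    refine ⟨r, h0, ?_⟩
    rwa [one_div, Real.inv_rpow h0.le, ← Real.rpow_neg h0.le]
  intro t ht
  obtain ⟨t₀, ht₀, hmax⟩ := isCompact_Icc.exists_isMaxOn ⟨t, ht⟩
    (f := fun s => Real.exp (-(r * s)) * w s) (by fun_prop)
  set M := Real.exp (-(r * t₀)) * w t₀ with hM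
  have hle : ∀ s ∈ Icc (0:ℝ) T, Real.exp (-(r * s)) * w s ≤ M := fun s hs => hmax hs
  have hwle : ∀ s ∈ Icc (0:ℝ) T, w s ≤ Real.exp (r * s) * M := fun s hs => by
    have := mul_le_mul_of_nonneg_left (hle s hs) (Real.exp_pos (r * s)).le
    rwa [← mul_assoc, ← Real.exp_add, add_neg_cancel, Real.exp_zero, one_mul] at this
  suffices hM0 : M ≤ 0 from (hwle t ht).trans (mul_nonpos_of_nonneg_of_nonpos (Real.exp_pos _).le hM0)
  by_contra! hMpos
  have hk := intervalIntegrable_abel_kernel hα t₀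
  have hsub : Icc 0 t₀ ⊆ Icc 0 T := Icc_subset_Icc_right ht₀.2
  have hint : ∫ s in (0:ℝ)..t₀, (t₀ - s) ^ (α - 1) * w s ≤
      ∫ s in (0:ℝ)..t₀, (t₀ - s) ^ (α - 1) * (Real.exp (r * s) * M) := by
    refine intervalIntegral.integral_mono_on ht₀.1
      (hk.mul_continuousOn (by rw [uIcc_of_le ht₀.1]; exact hwc.mono hsub))
      (hk.mul_continuousOn (by fun_prop)) fun s hs => ?_
    exact mul_le_mul_of_nonneg_left (hwle s (hsub hs))
      (Real.rpow_nonneg (sub_nonneg.2 hs.2) _)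
  have heq : ∫ s in (0:ℝ)..t₀, (t₀ - s) ^ (α - 1) * (Real.exp (r * s) * M) =
      Real.exp (r * t₀) * M *
        ∫ s in (0:ℝ)..t₀, (t₀ - s) ^ (α - 1) * Real.exp (-(r * (t₀ - s))) := by
    rw [← intervalIntegral.integral_const_mul]
    congr 1 with s
    rw [show r * s = r * t₀ + -(r * (t₀ - s)) by ring, Real.exp_add]
    ring
  have hwt : w t₀ ≤ Real.exp (r * t₀) * M * (C * ((1 / r) ^ α * Real.Gamma α)) := by
    calc w t₀ ≤ C * (Real.exp (r * t₀) * M *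
          ∫ s in (0:ℝ)..t₀, (t₀ - s) ^ (α - 1) * Real.exp (-(r * (t₀ - s)))) :=
        (hw t₀ ht₀).trans (mul_le_mul_of_nonneg_left (hint.trans_eq heq) hC)
      _ ≤ C * (Real.exp (r * t₀) * M * ((1 / r) ^ α * Real.Gamma α)) := by
        gcongr
        exact integral_abel_kernel_mul_exp_le hα hr ht₀.1
      _ = _ := by ring
  have hwt₀ : w t₀ = Real.exp (r * t₀) * M := by
    rw [hM, ← mul_assoc, ← Real.exp_add, add_neg_cancel, Real.exp_zero, one_mul]
  have hpos : 0 < Real.exp (r * t₀) * M := by positivity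
  nlinarith

/-- Uniqueness for Volterra equations with weakly singular kernel `(t - s) ^ (α - 1)` and locally
Lipschitz nonlinearity. -/
lemma eqOn_of_abel_volterra {E : Type*} [NormedAddCommGroup E] [NormedSpace ℝ E]
    {α c T : ℝ} (hα : 0 < α) {G : E → E} (hG : LocallyLipschitz G) {z₀ : E} {z₁ z₂ : ℝ → E}
    (hz₁c : ContinuousOn z₁ (Icc 0 T)) (hz₂c : ContinuousOn z₂ (Icc 0 T))
    (hz₁ : ∀ t ∈ Icc (0:ℝ) T,
      z₁ t = z₀ - c • ∫ s in (0:ℝ)..t, (t - s) ^ (α - 1) • G (z₁ s))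
    (hz₂ : ∀ t ∈ Icc (0:ℝ) T,
      z₂ t = z₀ - c • ∫ s in (0:ℝ)..t, (t - s) ^ (α - 1) • G (z₂ s)) :
    EqOn z₁ z₂ (Icc 0 T) := by
  obtain ⟨K, hK⟩ := hG.locallyLipschitzOn.exists_lipschitzOnWith_of_compact
    ((isCompact_Icc.image_of_continuousOn hz₁c).union (isCompact_Icc.image_of_continuousOn hz₂c))
  have hwc : ContinuousOn (fun t => ‖z₁ t - z₂ t‖) (Icc 0 T) := (hz₁c.sub hz₂c).norm
  have key := nonpos_of_le_integral_abel_kernel (C := |c| * K) hα (by positivity) hwc ?_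
  · exact fun t ht => sub_eq_zero.1 (norm_le_zero_iff.1 (key t ht))
  intro t ht
  have hsub : Icc 0 t ⊆ Icc 0 T := Icc_subset_Icc_right ht.2
  have hk := intervalIntegrable_abel_kernel hα t
  have hi : ∀ z : ℝ → E, ContinuousOn z (Icc 0 T) →
      IntervalIntegrable (fun s => (t - s) ^ (α - 1) • G (z s)) volume 0 t := fun z hz =>
    hk.smul_continuousOn (by
      rw [uIcc_of_le ht.1]
      exact hG.continuous.comp_continuousOn (hz.mono hsub))
  have hdiff : z₁ t - z₂ t =
      -(c • ∫ s in (0:ℝ)..t, (t - s) ^ (α - 1) • (G (z₁ s) - G (z₂ s))) := by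
    simp only [smul_sub]
    rw [intervalIntegral.integral_sub (hi z₁ hz₁c) (hi z₂ hz₂c), hz₁ t ht, hz₂ t ht, smul_sub]
    abel
  have hbound : ‖∫ s in (0:ℝ)..t, (t - s) ^ (α - 1) • (G (z₁ s) - G (z₂ s))‖ ≤
      ∫ s in (0:ℝ)..t, K * ((t - s) ^ (α - 1) * ‖z₁ s - z₂ s‖) := by
    refine intervalIntegral.norm_integral_le_of_norm_le ht.1 (ae_of_all _ fun s hs => ?_)
      ((hk.mul_continuousOn (by rw [uIcc_of_le ht.1]; exact hwc.mono hsub)).const_mul _)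
    have hs' : s ∈ Icc 0 T := hsub (Ioc_subset_Icc_self hs)
    have hnn : 0 ≤ (t - s) ^ (α - 1) := Real.rpow_nonneg (sub_nonneg.2 hs.2) _
    rw [norm_smul, Real.norm_of_nonneg hnn, mul_left_comm]
    exact mul_le_mul_of_nonneg_left
      (hK.norm_sub_le (.inl (mem_image_of_mem _ hs')) (.inr (mem_image_of_mem _ hs'))) hnn
  rw [intervalIntegral.integral_const_mul] at hbound
  rw [hdiff, norm_neg, norm_smul, Real.norm_eq_abs, mul_assoc]
  exact mul_le_mul_of_nonneg_left hbound (abs_nonneg c)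

/-- Uniqueness for the Volterra integral formulation of
`{}_0^C D_t^α z = -A f(z) z`, `z(0) = z₀`, when `F(z) = f(z)·z` is continuously
differentiable. -/
theorem nonlinear_fractional_uniqueness
    (d : ℕ) (α : ℝ) (hα : α ∈ Set.Ioo (0:ℝ) 1)
    (A : Matrix (Fin d) (Fin d) ℝ) (hA : A.PosSemidef)
    (f : EuclideanSpace ℝ (Fin d) → ℝ) (hf : Continuous f) (hfnn : ∀ y, 0 ≤ f y)
    (hF : ContDiff ℝ 1 (fun z : EuclideanSpace ℝ (Fin d) => f z • z))
    (T : ℝ) (hT : 0 < T) (z₀ : EuclideanSpace ℝ (Fin d))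
    (z₁ z₂ : ℝ → EuclideanSpace ℝ (Fin d))
    (hz₁c : ContinuousOn z₁ (Set.Icc 0 T)) (hz₂c : ContinuousOn z₂ (Set.Icc 0 T))
    (hz₁ : ∀ t ∈ Set.Icc (0:ℝ) T,
      z₁ t = z₀ - (1 / Real.Gamma α) •
        ∫ s in (0:ℝ)..t, (t - s) ^ (α - 1) • (f (z₁ s) • Matrix.toEuclideanLin A (z₁ s)))
    (hz₂ : ∀ t ∈ Set.Icc (0:ℝ) T,
      z₂ t = z₀ - (1 / Real.Gamma α) •
        ∫ s in (0:ℝ)..t, (t - s) ^ (α - 1) • (f (z₂ s) • Matrix.toEuclideanLin A (z₂ s))) :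
    Set.EqOn z₁ z₂ (Set.Icc 0 T) := by
  have hG : LocallyLipschitz (fun y : EuclideanSpace ℝ (Fin d) =>
      f y • Matrix.toEuclideanLin A y) := by
    have h : ContDiff ℝ 1 (fun y : EuclideanSpace ℝ (Fin d) =>
        (Matrix.toEuclideanLin A).toContinuousLinearMap (f y • y)) :=
      (Matrix.toEuclideanLin A).toContinuousLinearMap.contDiff.comp hF
    simpa using h.locallyLipschitz
  exact eqOn_of_abel_volterra hα.1 hG hz₁c hz₂c hz₁ hz₂
end

section
/- Let α ∈ (0,1), a < b reals, B a real d×N matrix, and let Φ : [a,b) → ℝ^{d×d} be such that t ↦ (b−t)^{1−α} Φ(t) extends to a continuous function on [a,b]. Then the following are equivalent: (1) for every w ∈ ℝ^d there exists a continuous control u : [a,b] → ℝ^N with ∫_a^b Φ(t) B u(t) dt = w (controllability); (2) there exists a constant C > 0 such that for every z_b ∈ ℝ^d, ‖z_b‖² ≤ C ∫_a^b ‖(b−t)^{1−α} Bᵀ Φ(t)ᵀ z_b‖² dt (observability of the adjoint system). -/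
open MeasureTheory Set Matrix

section Duality

variable {E F : Type*}
  [NormedAddCommGroup E] [InnerProductSpace ℝ E] [NormedAddCommGroup F] [InnerProductSpace ℝ F]

open ContinuousLinearMap (adjoint)

lemma continuous_integral_sq_norm_apply {G : ℝ → E →L[ℝ] F} (hG : Continuous G) (a b : ℝ) :
    Continuous fun z => ∫ t in a..b, ‖G t z‖ ^ 2 := by
  apply intervalIntegral.continuous_parametric_intervalIntegral_of_continuous'
  simp only [Function.uncurry_def]
  fun_prop

lemma integral_sq_norm_apply_pos {G : ℝ → E →L[ℝ] F} (hG : Continuous G) {a b : ℝ} (hab : a < b)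
    {z : E} (hz : ∃ t ∈ Icc a b, G t z ≠ 0) : 0 < ∫ t in a..b, ‖G t z‖ ^ 2 := by
  obtain ⟨t, ht, hne⟩ := hz
  have hc : Continuous fun t => ‖G t z‖ ^ 2 := by fun_prop
  exact intervalIntegral.integral_pos hab hc.continuousOn (fun _ _ => by positivity)
    ⟨t, ht, by positivity⟩

lemma integral_sq_norm_apply_eq_zero {G : ℝ → E →L[ℝ] F} (hG : Continuous G) {a b : ℝ}
    (hab : a ≤ b) {ρ : ℝ → ℝ} (hρ : IntervalIntegrable ρ volume a b)
    (hρpos : ∀ t ∈ Ioo a b, 0 < ρ t) {z : E}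
    (hz : ∫ t in a..b, ρ t * ‖G t z‖ ^ 2 = 0) : ∫ t in a..b, ‖G t z‖ ^ 2 = 0 := by
  have hc : Continuous fun t => ‖G t z‖ ^ 2 := by fun_prop
  have hint : IntervalIntegrable (fun t => ρ t * ‖G t z‖ ^ 2) volume a b :=
    hρ.mul_continuousOn hc.continuousOn
  rw [intervalIntegral.integral_of_le hab, integral_Ioc_eq_integral_Ioo] at hz ⊢
  rw [setIntegral_eq_zero_iff_of_nonneg_ae] at hz
  · refine integral_eq_zero_of_ae ?_
    filter_upwards [hz, ae_restrict_mem measurableSet_Ioo] with t ht hmem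
    exact (mul_eq_zero.1 ht).resolve_left (hρpos t hmem).ne'
  · filter_upwards [ae_restrict_mem measurableSet_Ioo] with t hmem
    exact mul_nonneg (hρpos t hmem).le (by positivity)
  · exact ((intervalIntegrable_iff_integrableOn_Ioc_of_le hab).1 hint).mono_set Ioo_subset_Ioc_self

variable [FiniteDimensional ℝ E]

/-- A continuous quadratic energy that is positive off zero is coercive, by compactness of the
unit sphere. -/
lemma exists_sq_norm_le_mul_integral {G : ℝ → E →L[ℝ] F} (hG : Continuous G) {a b : ℝ}
    (hpos : ∀ z : E, z ≠ 0 → 0 < ∫ t in a..b, ‖G t z‖ ^ 2) :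
    ∃ C : ℝ, 0 < C ∧ ∀ z : E, ‖z‖ ^ 2 ≤ C * ∫ t in a..b, ‖G t z‖ ^ 2 := by
  rcases subsingleton_or_nontrivial E with hE | hE
  · refine ⟨1, one_pos, fun z => ?_⟩
    simp [Subsingleton.elim z 0]
  obtain ⟨z₀, hz₀, hmin⟩ := (isCompact_sphere (0 : E) 1).exists_isMinOn
    (NormedSpace.sphere_nonempty.2 zero_le_one)
    (continuous_integral_sq_norm_apply hG a b).continuousOn
  have hz₀ne : z₀ ≠ 0 := by
    rintro rfl
    simp at hz₀
  have hm := hpos z₀ hz₀ne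
  refine ⟨_, inv_pos.2 hm, fun z => ?_⟩
  rcases eq_or_ne z 0 with rfl | hz
  · simp
  have hzn : 0 < ‖z‖ := norm_pos_iff.2 hz
  have hle := hmin (a := ‖z‖⁻¹ • z) (by simp [norm_smul, hzn.ne'])
  simp only [mem_ofPred_eq, map_smul, norm_smul, mul_pow, norm_inv, norm_norm,
    intervalIntegral.integral_const_mul] at hle
  rw [inv_mul_eq_div, le_div_iff₀ hm]
  calc ‖z‖ ^ 2 * ∫ t in a..b, ‖G t z₀‖ ^ 2
      ≤ ‖z‖ ^ 2 * (‖z‖⁻¹ ^ 2 * ∫ t in a..b, ‖G t z‖ ^ 2) := by gcongr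
    _ = ∫ t in a..b, ‖G t z‖ ^ 2 := by field_simp

variable [CompleteSpace F]

lemma intervalIntegrable_smul_adjoint_apply {G : ℝ → E →L[ℝ] F} (hG : Continuous G) {a b : ℝ}
    (hab : a ≤ b) {ρ : ℝ → ℝ} (hρ : IntervalIntegrable ρ volume a b) {u : ℝ → F}
    (hu : ContinuousOn u (Icc a b)) :
    IntervalIntegrable (fun t => ρ t • adjoint (G t) (u t)) volume a b := by
  refine hρ.smul_continuousOn ?_
  rw [uIcc_of_le hab]
  have hA : Continuous fun t => adjoint (G t) := adjoint.continuous.comp hG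
  exact hA.continuousOn.clm_apply hu

lemma inner_integral_smul_adjoint_apply {G : ℝ → E →L[ℝ] F} (hG : Continuous G) {a b : ℝ}
    (hab : a ≤ b) {ρ : ℝ → ℝ} (hρ : IntervalIntegrable ρ volume a b) {u : ℝ → F}
    (hu : ContinuousOn u (Icc a b)) (z : E) :
    inner ℝ z (∫ t in a..b, ρ t • adjoint (G t) (u t)) =
      ∫ t in a..b, ρ t * inner ℝ (G t z) (u t) := by
  have h := (innerSL ℝ z).intervalIntegral_comp_comm
    (intervalIntegrable_smul_adjoint_apply hG hab hρ hu)
  simp only [innerSL_apply_apply, inner_smul_right,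
    ContinuousLinearMap.adjoint_inner_right] at h
  exact h.symm

/-- Surjectivity of the weighted input map on continuous controls is equivalent to the
observability inequality for the adjoint output map. -/
theorem forall_exists_integral_adjoint_eq_iff {G : ℝ → E →L[ℝ] F} (hG : Continuous G) {a b : ℝ}
    (hab : a < b) {ρ : ℝ → ℝ} (hρ : IntervalIntegrable ρ volume a b)
    (hρpos : ∀ t ∈ Ioo a b, 0 < ρ t) :
    (∀ w : E, ∃ u : ℝ → F, ContinuousOn u (Icc a b) ∧
        ∫ t in a..b, ρ t • adjoint (G t) (u t) = w) ↔
      ∃ C : ℝ, 0 < C ∧ ∀ z : E, ‖z‖ ^ 2 ≤ C * ∫ t in a..b, ‖G t z‖ ^ 2 := by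
  constructor
  · refine fun h => exists_sq_norm_le_mul_integral hG fun z hz => ?_
    refine integral_sq_norm_apply_pos hG hab ?_
    by_contra! hzero
    obtain ⟨u, hu, huz⟩ := h z
    refine hz (inner_self_eq_zero (𝕜 := ℝ).1 ?_)
    nth_rewrite 2 [← huz]
    rw [inner_integral_smul_adjoint_apply hG hab.le hρ hu,
      intervalIntegral.integral_congr (g := fun _ => (0 : ℝ)) fun t ht => ?_]
    · simp
    · rw [uIcc_of_le hab.le] at ht
      simp [hzero t ht]
  · rintro ⟨C, -, hC⟩ w
    have hcont (z : E) : ContinuousOn (fun t => G t z) (Icc a b) := by fun_prop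
    have hint (z : E) := intervalIntegrable_smul_adjoint_apply hG hab.le hρ (hcont z)
    let gramian : E →ₗ[ℝ] E :=
      { toFun := fun z => ∫ t in a..b, ρ t • adjoint (G t) (G t z)
        map_add' := fun x y => by
          simp only [map_add, smul_add]
          exact intervalIntegral.integral_add (hint x) (hint y)
        map_smul' := fun c x => by
          simp only [map_smul, smul_comm _ c, intervalIntegral.integral_smul, RingHom.id_apply] }
    have hinj : Function.Injective gramian := by
      refine (injective_iff_map_eq_zero gramian).2 fun z hz => ?_
      have h := inner_integral_smul_adjoint_apply hG hab.le hρ (hcont z) z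
      rw [show ∫ t in a..b, ρ t • adjoint (G t) (G t z) = 0 from hz, inner_zero_right] at h
      simp only [real_inner_self_eq_norm_sq] at h
      have hle := hC z
      rw [integral_sq_norm_apply_eq_zero hG hab.le hρ hρpos h.symm, mul_zero] at hle
      exact norm_eq_zero.1 (pow_eq_zero_iff two_ne_zero |>.1 (le_antisymm hle (sq_nonneg _)))
    obtain ⟨z, hz⟩ := LinearMap.injective_iff_surjective.1 hinj w
    exact ⟨fun t => G t z, hcont z, hz⟩

end Duality

/-- Controllability of the linear fractional system is equivalent to the
observability inequality for the adjoint system. -/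
theorem controllability_iff_observability
    (d N : ℕ) (α a b : ℝ) (hα : α ∈ Set.Ioo (0:ℝ) 1) (hab : a < b)
    (B : Matrix (Fin d) (Fin N) ℝ)
    (Φ : ℝ → Matrix (Fin d) (Fin d) ℝ)
    (Φe : ℝ → Matrix (Fin d) (Fin d) ℝ) (hΦe : ContinuousOn Φe (Set.Icc a b))
    (hext : ∀ t ∈ Set.Ico a b, Φe t = (b - t) ^ (1 - α) • Φ t) :
    (∀ w : EuclideanSpace ℝ (Fin d), ∃ u : ℝ → EuclideanSpace ℝ (Fin N),
        ContinuousOn u (Set.Icc a b) ∧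
        (∫ t in a..b, Matrix.toEuclideanLin (Φ t * B) (u t)) = w)
    ↔ (∃ C : ℝ, 0 < C ∧ ∀ zb : EuclideanSpace ℝ (Fin d),
        ‖zb‖ ^ 2 ≤ C * ∫ t in a..b,
          ‖(b - t) ^ (1 - α) • Matrix.toEuclideanLin (Bᵀ * (Φ t)ᵀ) zb‖ ^ 2) := by
  let L : Matrix (Fin N) (Fin d) ℝ →ₗ[ℝ] EuclideanSpace ℝ (Fin d) →L[ℝ] EuclideanSpace ℝ (Fin N) :=
    (Matrix.toEuclideanLin.trans LinearMap.toContinuousLinearMap).toLinearMap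
  have hL (M : Matrix (Fin N) (Fin d) ℝ) (z) : L M z = Matrix.toEuclideanLin M z := rfl
  have hLadj (M : Matrix (Fin d) (Fin N) ℝ) (v) :
      ContinuousLinearMap.adjoint (L Mᵀ) v = Matrix.toEuclideanLin M v := by
    refine ext_inner_left ℝ fun z => ?_
    rw [ContinuousLinearMap.adjoint_inner_right, hL, ← conjTranspose_eq_transpose_of_trivial,
      Matrix.toEuclideanLin_conjTranspose_eq_adjoint, LinearMap.adjoint_inner_left]
  let G : ℝ → EuclideanSpace ℝ (Fin d) →L[ℝ] EuclideanSpace ℝ (Fin N) :=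
    fun t => L (IccExtend hab.le ((Icc a b).domRestrict Φe) t * B)ᵀ
  have hG : Continuous G := by
    have h : Continuous (IccExtend hab.le ((Icc a b).domRestrict Φe)) :=
      (continuousOn_iff_continuous_domRestrict.1 hΦe).Icc_extend'
    exact L.continuous_of_finiteDimensional.comp (h.matrix_mul continuous_const).matrix_transpose
  have hρ : IntervalIntegrable (fun t => (b - t) ^ (α - 1)) volume a b := by
    have h := (intervalIntegral.intervalIntegrable_rpow' (a := b - a) (b := 0)
      (r := α - 1) (by linarith [hα.1])).comp_sub_left b
    simpa using h
  have hρpos : ∀ t ∈ Ioo a b, 0 < (b - t) ^ (α - 1) := fun t ht =>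
    Real.rpow_pos_of_pos (sub_pos.2 ht.2) _
  have hGt (t : ℝ) (ht : t ∈ Ioo a b) : G t = L ((b - t) ^ (1 - α) • (Φ t * B))ᵀ := by
    have h : IccExtend hab.le ((Icc a b).domRestrict Φe) t = (b - t) ^ (1 - α) • Φ t :=
      (IccExtend_of_mem _ _ (Ioo_subset_Icc_self ht)).trans (hext t (Ioo_subset_Ico_self ht))
    simp only [G, h, Matrix.smul_mul]
  have hctrl (u : ℝ → EuclideanSpace ℝ (Fin N)) :
      ∫ t in a..b, Matrix.toEuclideanLin (Φ t * B) (u t) =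
        ∫ t in a..b, (b - t) ^ (α - 1) • ContinuousLinearMap.adjoint (G t) (u t) := by
    refine intervalIntegral.integral_congr_Ioo_of_le hab.le fun t ht => ?_
    have hbt : 0 < b - t := sub_pos.2 ht.2
    simp only [hGt t ht, hLadj, map_smul, LinearMap.smul_apply, smul_smul]
    rw [← Real.rpow_add hbt]
    simp
  have hobs (z : EuclideanSpace ℝ (Fin d)) :
      ∫ t in a..b, ‖(b - t) ^ (1 - α) • Matrix.toEuclideanLin (Bᵀ * (Φ t)ᵀ) z‖ ^ 2 =
        ∫ t in a..b, ‖G t z‖ ^ 2 := by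
    refine intervalIntegral.integral_congr_Ioo_of_le hab.le fun t ht => ?_
    simp only [hGt t ht, Matrix.transpose_smul, Matrix.transpose_mul, map_smul,
      _root_.smul_apply, hL]
  simp only [hctrl, hobs]
  exact forall_exists_integral_adjoint_eq_iff hG hab hρ hρpos
end

section
/- Let α ∈ (0,1), a < b reals, B a real d×N matrix, y₀, y_b ∈ ℝ^d, and let Φ : [a,b) → ℝ^{d×d} be such that t ↦ (b−t)^{1−α} Φ(t) extends to a continuous function on [a,b]. For z_b ∈ ℝ^d set z₀(z_b) = (1/Γ(1−α)) ∫_a^b (τ−a)^{−α} Φ(τ)ᵀ z_b dτ and define the functional J : ℝ^d → ℝ by J(z_b) = (1/2) ∫_a^b (b−t)^{1−α} ‖Bᵀ Φ(t)ᵀ z_b‖² dt − ⟨y_b, z_b⟩ + ⟨y₀, z₀(z_b)⟩. Assume the observability inequality: there exists C > 0 such that ‖z_b‖² ≤ C ∫_a^b ‖(b−t)^{1−α} Bᵀ Φ(t)ᵀ z_b‖² dt for all z_b ∈ ℝ^d. Then J is coercive (J(z_b) → +∞ as ‖z_b‖ → ∞) and J attains a global minimum on ℝ^d. -/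
open MeasureTheory Set Matrix
open scoped RealInnerProductSpace

/-- A quadratic functional whose quadratic part is bounded below by a positive multiple of the
squared norm is coercive. -/
theorem coercive_of_quadratic_lower_bound {E : Type*} [NormedAddCommGroup E]
    [InnerProductSpace ℝ E] {Q : E → ℝ} {k : ℝ} (hk : 0 < k) (hQ : ∀ z, k * ‖z‖ ^ 2 ≤ Q z)
    (l : E →L[ℝ] ℝ) (c : ℝ) : ∃ R : ℝ, ∀ z : E, R ≤ ‖z‖ → c ≤ (1 / 2) * Q z + l z := by
  refine ⟨max 1 (2 * (‖l‖ + |c|) / k), fun z hz => ?_⟩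
  have h1 : 1 ≤ ‖z‖ := (le_max_left _ _).trans hz
  have h2 : 2 * (‖l‖ + |c|) ≤ ‖z‖ * k := (div_le_iff₀ hk).1 ((le_max_right _ _).trans hz)
  have hl : -(‖l‖ * ‖z‖) ≤ l z := (abs_le.1 (l.le_opNorm z)).1
  nlinarith [hQ z, le_abs_self c, abs_nonneg c, mul_le_mul_of_nonneg_left h2 (norm_nonneg z),
    mul_le_mul_of_nonneg_right h1 (abs_nonneg c)]

theorem exists_forall_le_of_coercive {E : Type*} [NormedAddCommGroup E] [ProperSpace E]
    {J : E → ℝ} (hJ : Continuous J) (h : ∀ c : ℝ, ∃ R : ℝ, ∀ z : E, R ≤ ‖z‖ → c ≤ J z) :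
    ∃ z, ∀ w, J z ≤ J w := by
  refine hJ.exists_forall_le (Filter.tendsto_atTop.2 fun c => ?_)
  obtain ⟨R, hR⟩ := h c
  filter_upwards [tendsto_norm_cocompact_atTop.eventually_ge_atTop R] with z hz using hR z hz

theorem intervalIntegrable_rpow_sub_left {b r : ℝ} (hr : -1 < r) (u v : ℝ) :
    IntervalIntegrable (fun t => (b - t) ^ r) volume u v := by
  have h := intervalIntegral.intervalIntegrable_rpow' (a := b - u) (b := b - v) hr
  simpa only [sub_sub_cancel] using h.comp_sub_left b enorm_ne_top

theorem intervalIntegrable_rpow_sub_right {a r : ℝ} (hr : -1 < r) (u v : ℝ) :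
    IntervalIntegrable (fun t => (t - a) ^ r) volume u v := by
  have h := intervalIntegral.intervalIntegrable_rpow' (a := u - a) (b := v - a) hr
  simpa only [sub_add_cancel] using h.comp_sub_right a enorm_ne_top

/-- The Beta-type weight on `[a, b]` is integrable. -/
theorem intervalIntegrable_rpow_mul_rpow {a b r s : ℝ} (hab : a < b) (hr : -1 < r) (hs : -1 < s) :
    IntervalIntegrable (fun t => (t - a) ^ r * (b - t) ^ s) volume a b := by
  have hm : a < (a + b) / 2 ∧ (a + b) / 2 < b := ⟨by linarith, by linarith⟩
  refine IntervalIntegrable.trans (b := (a + b) / 2) ?_ ?_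
  · refine (intervalIntegrable_rpow_sub_right hr _ _).mul_continuousOn fun t ht => ?_
    rw [uIcc_of_le hm.1.le] at ht
    exact ((continuousAt_const.sub continuousAt_id).rpow_const
      (Or.inl (sub_pos.2 (ht.2.trans_lt hm.2)).ne')).continuousWithinAt
  · refine (intervalIntegrable_rpow_sub_left hs _ _).continuousOn_mul fun t ht => ?_
    rw [uIcc_of_le hm.2.le] at ht
    exact ((continuousAt_id.sub continuousAt_const).rpow_const
      (Or.inl (sub_pos.2 (hm.1.trans_le ht.1)).ne')).continuousWithinAt

theorem rpow_mul_rpow_conjugate {x : ℝ} (hx : 0 < x) (α : ℝ) :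
    x ^ (1 - α) * x ^ (α - 1) = 1 := by
  rw [← Real.rpow_add hx]
  simp

/-- The weighted quadratic form `z ↦ ∫ (b - t) ^ (α - 1) * ‖L t z‖ ^ 2` of a continuous family of
operators is continuous. -/
theorem continuous_weighted_quadratic {E F : Type*} [NormedAddCommGroup E]
    [InnerProductSpace ℝ E] [CompleteSpace E] [NormedAddCommGroup F]
    [InnerProductSpace ℝ F] [CompleteSpace F] {a b r : ℝ} (hr : -1 < r)
    {L : ℝ → E →L[ℝ] F} (hL : ContinuousOn L (uIcc a b)) :
    Continuous fun z => ∫ t in a..b, (b - t) ^ r * ‖L t z‖ ^ 2 := by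
  set P : ℝ → E →L[ℝ] E :=
    fun t => (b - t) ^ r • ((ContinuousLinearMap.adjoint (L t)).comp (L t)) with hPdef
  have hP : IntervalIntegrable P volume a b :=
    (intervalIntegrable_rpow_sub_left hr _ _).smul_continuousOn
      (ContinuousOn.clm_comp (ContinuousLinearMap.adjoint.continuous.comp_continuousOn hL) hL)
  have hPL : ∀ t z, ⟪z, P t z⟫ = (b - t) ^ r * ‖L t z‖ ^ 2 := fun t z => by
    simp only [hPdef, _root_.smul_apply, ContinuousLinearMap.comp_apply, inner_smul_right,
      ContinuousLinearMap.adjoint_inner_right, real_inner_self_eq_norm_sq]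
  have hq : ∀ z, ∫ t in a..b, (b - t) ^ r * ‖L t z‖ ^ 2 = ⟪z, (∫ t in a..b, P t) z⟫ := fun z => by
    simp only [← hPL]
    exact ((innerSL ℝ z).comp (ContinuousLinearMap.apply ℝ _ z)).intervalIntegral_comp_comm hP
  simp only [hq]
  fun_prop

/-- On a bounded interval, the unweighted quadratic form is controlled by the weighted one. -/
theorem integral_norm_sq_le_weighted {E F : Type*} [NormedAddCommGroup E] [NormedSpace ℝ E]
    [NormedAddCommGroup F] [NormedSpace ℝ F] {a b α : ℝ} (hα0 : 0 < α) (hα1 : α < 1)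
    (hab : a < b) {L : ℝ → E →L[ℝ] F} (hL : ContinuousOn L (uIcc a b)) (z : E) :
    ∫ t in a..b, ‖L t z‖ ^ 2 ≤
      (b - a) ^ (1 - α) * ∫ t in a..b, (b - t) ^ (α - 1) * ‖L t z‖ ^ 2 := by
  have hcont : ContinuousOn (fun t => ‖L t z‖ ^ 2) (uIcc a b) :=
    (hL.clm_apply continuousOn_const).norm.pow 2
  rw [← intervalIntegral.integral_const_mul]
  refine intervalIntegral.integral_mono_on_of_le_Ioo hab.le hcont.intervalIntegrable
    (((intervalIntegrable_rpow_sub_left (by linarith) _ _).mul_continuousOn hcont).const_mul _)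
    fun t ht => ?_
  have hpos : 0 < b - t := sub_pos.2 ht.2
  have hle : (b - t) ^ (1 - α) ≤ (b - a) ^ (1 - α) :=
    Real.rpow_le_rpow hpos.le (by linarith [ht.1]) (by linarith)
  rw [← mul_assoc]
  exact le_mul_of_one_le_left (sq_nonneg _) ((rpow_mul_rpow_conjugate hpos α).symm.le.trans
    (mul_le_mul_of_nonneg_right hle (Real.rpow_nonneg hpos.le _)))

/-- A matrix as a continuous linear map between Euclidean spaces. -/
noncomputable def Matrix.euclideanCLM {m n : ℕ} :
    Matrix (Fin m) (Fin n) ℝ →ₗ[ℝ] (EuclideanSpace ℝ (Fin n) →L[ℝ] EuclideanSpace ℝ (Fin m)) :=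
  LinearMap.toContinuousLinearMap.toLinearMap ∘ₗ (Matrix.toEuclideanLin (𝕜 := ℝ)).toLinearMap

theorem Matrix.euclideanCLM_apply {m n : ℕ} (A : Matrix (Fin m) (Fin n) ℝ)
    (z : EuclideanSpace ℝ (Fin n)) : Matrix.euclideanCLM A z = Matrix.toEuclideanLin A z := rfl

theorem Matrix.continuous_euclideanCLM {m n : ℕ} :
    Continuous (Matrix.euclideanCLM (m := m) (n := n)) :=
  LinearMap.continuous_of_finiteDimensional _

theorem Matrix.continuousOn_euclideanCLM_mul_transpose {m n p : ℕ}
    (A : Matrix (Fin m) (Fin n) ℝ) {M : ℝ → Matrix (Fin p) (Fin n) ℝ} {s : Set ℝ}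
    (hM : ContinuousOn M s) : ContinuousOn (fun t => Matrix.euclideanCLM (A * (M t)ᵀ)) s :=
  Matrix.continuous_euclideanCLM.comp_continuousOn
    ((continuous_const.matrix_mul continuous_id.matrix_transpose).comp_continuousOn hM)

theorem Matrix.toEuclideanLin_mul_transpose_smul {m n p : ℕ} (A : Matrix (Fin m) (Fin n) ℝ)
    (M : Matrix (Fin p) (Fin n) ℝ) (c : ℝ) (z : EuclideanSpace ℝ (Fin p)) :
    Matrix.toEuclideanLin (A * (c • M)ᵀ) z = c • Matrix.euclideanCLM (A * Mᵀ) z := by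
  rw [Matrix.transpose_smul, Matrix.mul_smul, map_smul, LinearMap.smul_apply,
    Matrix.euclideanCLM_apply]

/-- An integral of vectors `w t • L t z` with integrable weight and continuous `L` depends
linearly and continuously on `z`. -/
theorem exists_clm_integral_smul {E F : Type*} [NormedAddCommGroup E] [NormedSpace ℝ E]
    [NormedAddCommGroup F] [NormedSpace ℝ F] [CompleteSpace F] {a b : ℝ} {w : ℝ → ℝ}
    (hw : IntervalIntegrable w volume a b) {L : ℝ → E →L[ℝ] F}
    (hL : ContinuousOn L (uIcc a b)) :
    ∃ S : E →L[ℝ] F, ∀ z, ∫ t in a..b, w t • L t z = S z :=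
  ⟨∫ t in a..b, w t • L t, fun z =>
    (ContinuousLinearMap.intervalIntegral_apply (hw.smul_continuousOn hL) z).symm⟩

/-- Under the observability inequality, the quadratic functional `J` is
coercive and attains a global minimum on `ℝ^d`. -/
theorem functional_J_coercive_and_attains_min
    (d N : ℕ) (α a b : ℝ) (hα : α ∈ Set.Ioo (0:ℝ) 1) (hab : a < b)
    (B : Matrix (Fin d) (Fin N) ℝ) (y₀ yb : EuclideanSpace ℝ (Fin d))
    (Φ : ℝ → Matrix (Fin d) (Fin d) ℝ)
    (Φe : ℝ → Matrix (Fin d) (Fin d) ℝ) (hΦe : ContinuousOn Φe (Set.Icc a b))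
    (hext : ∀ t ∈ Set.Ico a b, Φe t = (b - t) ^ (1 - α) • Φ t)
    (z0 : EuclideanSpace ℝ (Fin d) → EuclideanSpace ℝ (Fin d))
    (hz0 : ∀ zb, z0 zb = (1 / Real.Gamma (1 - α)) •
      ∫ τ in a..b, (τ - a) ^ (-α) • Matrix.toEuclideanLin (Φ τ)ᵀ zb)
    (J : EuclideanSpace ℝ (Fin d) → ℝ)
    (hJ : ∀ zb, J zb = (1 / 2) *
        (∫ t in a..b, (b - t) ^ (1 - α) * ‖Matrix.toEuclideanLin (Bᵀ * (Φ t)ᵀ) zb‖ ^ 2)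
      - ⟪yb, zb⟫ + ⟪y₀, z0 zb⟫)
    (hobs : ∃ C : ℝ, 0 < C ∧ ∀ zb : EuclideanSpace ℝ (Fin d),
      ‖zb‖ ^ 2 ≤ C * ∫ t in a..b,
        ‖(b - t) ^ (1 - α) • Matrix.toEuclideanLin (Bᵀ * (Φ t)ᵀ) zb‖ ^ 2) :
    (∀ c : ℝ, ∃ R : ℝ, ∀ zb : EuclideanSpace ℝ (Fin d), R ≤ ‖zb‖ → c ≤ J zb) ∧
    (∃ zmin : EuclideanSpace ℝ (Fin d), ∀ zb, J zmin ≤ J zb) := by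
  obtain ⟨hα0, hα1⟩ := hα
  obtain ⟨C, hC, hobs⟩ := hobs
  have hΦ : ∀ t ∈ Ioo a b, Φ t = (b - t) ^ (α - 1) • Φe t := fun t ht => by
    rw [hext t ⟨ht.1.le, ht.2⟩, smul_smul, mul_comm, rpow_mul_rpow_conjugate (sub_pos.2 ht.2),
      one_smul]
  rw [← uIcc_of_le hab.le] at hΦe
  have hT := Matrix.continuousOn_euclideanCLM_mul_transpose (1 : Matrix (Fin d) (Fin d) ℝ) hΦe
  have hL := Matrix.continuousOn_euclideanCLM_mul_transpose Bᵀ hΦe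
  obtain ⟨S, hS⟩ := exists_clm_integral_smul
    (intervalIntegrable_rpow_mul_rpow hab (r := -α) (s := α - 1) (by linarith) (by linarith)) hT
  have hz0S : ∀ zb, z0 zb = (1 / Real.Gamma (1 - α)) • S zb := fun zb => by
    rw [hz0, ← hS]
    congr 1
    refine intervalIntegral.integral_congr_Ioo_of_le hab.le fun t ht => ?_
    rw [← Matrix.one_mul (Φ t)ᵀ, hΦ t ht, Matrix.toEuclideanLin_mul_transpose_smul, smul_smul]
  have hquad : ∀ zb, (∫ t in a..b, (b - t) ^ (1 - α) *
      ‖Matrix.toEuclideanLin (Bᵀ * (Φ t)ᵀ) zb‖ ^ 2) =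
      ∫ t in a..b, (b - t) ^ (α - 1) * ‖Matrix.euclideanCLM (Bᵀ * (Φe t)ᵀ) zb‖ ^ 2 := fun zb => by
    refine intervalIntegral.integral_congr_Ioo_of_le hab.le fun t ht => ?_
    rw [hΦ t ht, Matrix.toEuclideanLin_mul_transpose_smul, norm_smul, mul_pow, Real.norm_eq_abs,
      sq_abs]
    linear_combination (b - t) ^ (α - 1) * ‖Matrix.euclideanCLM (Bᵀ * (Φe t)ᵀ) zb‖ ^ 2 *
      rpow_mul_rpow_conjugate (sub_pos.2 ht.2) α
  have hobsL : ∀ zb, (∫ t in a..b, ‖(b - t) ^ (1 - α) •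
      Matrix.toEuclideanLin (Bᵀ * (Φ t)ᵀ) zb‖ ^ 2) =
      ∫ t in a..b, ‖Matrix.euclideanCLM (Bᵀ * (Φe t)ᵀ) zb‖ ^ 2 := fun zb => by
    refine intervalIntegral.integral_congr_Ioo_of_le hab.le fun t ht => ?_
    rw [hΦ t ht, Matrix.toEuclideanLin_mul_transpose_smul, smul_smul,
      rpow_mul_rpow_conjugate (sub_pos.2 ht.2), one_smul]
  have hD : 0 < (b - a) ^ (1 - α) := Real.rpow_pos_of_pos (sub_pos.2 hab) _
  have hlow : ∀ zb, (C * (b - a) ^ (1 - α))⁻¹ * ‖zb‖ ^ 2 ≤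
      ∫ t in a..b, (b - t) ^ (α - 1) * ‖Matrix.euclideanCLM (Bᵀ * (Φe t)ᵀ) zb‖ ^ 2 := fun zb => by
    rw [inv_mul_le_iff₀ (mul_pos hC hD), mul_assoc]
    exact ((hobs zb).trans_eq (by rw [hobsL])).trans
      (mul_le_mul_of_nonneg_left (integral_norm_sq_le_weighted hα0 hα1 hab hL zb) hC.le)
  obtain ⟨l, hl⟩ : ∃ l : EuclideanSpace ℝ (Fin d) →L[ℝ] ℝ,
      ∀ zb, l zb = -⟪yb, zb⟫ + ⟪y₀, z0 zb⟫ :=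
    ⟨-innerSL ℝ yb + (innerSL ℝ y₀).comp ((1 / Real.Gamma (1 - α)) • S), fun zb => by
      rw [hz0S]; rfl⟩
  have hJ' : J = fun zb => (1 / 2) * (∫ t in a..b, (b - t) ^ (α - 1) *
      ‖Matrix.euclideanCLM (Bᵀ * (Φe t)ᵀ) zb‖ ^ 2) + l zb := by
    funext zb
    rw [hJ, hquad, hl]
    ring
  have hcoer : ∀ c : ℝ, ∃ R : ℝ, ∀ zb, R ≤ ‖zb‖ → c ≤ J zb := by
    rw [hJ']
    exact coercive_of_quadratic_lower_bound (inv_pos.2 (mul_pos hC hD)) hlow l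
  refine ⟨hcoer, exists_forall_le_of_coercive ?_ hcoer⟩
  rw [hJ']
  exact (continuous_const.mul (continuous_weighted_quadratic (by linarith) hL)).add l.continuous
end
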